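/- (Bernstein–Szegő approximation; Verblunsky, Geronimus.) Let μ be a nontrivial probability measure on the unit circle with orthonormal polynomials φ_n and Verblunsky coefficients α_j(dμ). Define dμ_n = dθ/(2π·|φ_n(e^{iθ}; dμ)|²). Then μ_n is a probability measure on ∂𝔻, and its Verblunsky coefficients are α_j(dμ_n) = α_j(dμ) for j ≤ n − 1 and α_j(dμ_n) = 0 for j ≥ n. -/

import Mathlib

open MeasureTheory Polynomial Filter

noncomputable section

/-- A nontrivial probability measure on the unit circle: a probability measure on `ℂ`
supported on `{z : ‖z‖ = 1}` that is not concentrated on any finite set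
(equivalently, its support is infinite). -/
structure IsNontrivialOnCircle (μ : Measure ℂ) : Prop where
  prob : IsProbabilityMeasure μ
  onCircle : μ {z : ℂ | ‖z‖ = 1}ᶜ = 0
  infiniteSupport : ∀ s : Finset ℂ, μ ((↑s : Set ℂ)ᶜ) ≠ 0

/-- `Φ` is the family of monic orthogonal polynomials for `μ`: each `Φ n` is monic of
degree `n` and orthogonal in `L²(∂𝔻, dμ)` to `z^j` for `j = 0, …, n-1`. -/
def IsMonicOPUC (μ : Measure ℂ) (Φ : ℕ → Polynomial ℂ) : Prop :=
  ∀ n : ℕ, ((Φ n).Monic ∧ (Φ n).natDegree = n) ∧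
    ∀ j < n, ∫ z, (starRingEnd ℂ) z ^ j * (Φ n).eval z ∂μ = 0

/-- Verblunsky coefficients: `α n = -conj (Φ (n+1) (0))`. -/
def verblunsky (Φ : ℕ → Polynomial ℂ) (n : ℕ) : ℂ :=
  - (starRingEnd ℂ) ((Φ (n + 1)).eval 0)

/-- Squared `L²(dμ)` norm of a polynomial. -/
def polyNormSq (μ : Measure ℂ) (P : Polynomial ℂ) : ℝ :=
  ∫ z, ‖P.eval z‖ ^ 2 ∂μ

/-- Orthonormal polynomial: `φ = Φ / ‖Φ‖_{L²(dμ)}`. -/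
def orthonormalize (μ : Measure ℂ) (P : Polynomial ℂ) : Polynomial ℂ :=
  Polynomial.C ((Real.sqrt (polyNormSq μ P) : ℂ))⁻¹ * P

/-- The reversed polynomial `P^{*,n}(z) = z^n conj (P (1/conj z))`. -/
def revStar (n : ℕ) (P : Polynomial ℂ) : Polynomial ℂ :=
  ∑ j ∈ Finset.range (n + 1),
    Polynomial.C ((starRingEnd ℂ) (P.coeff (n - j))) * Polynomial.X ^ j

/-- The Bernstein–Szegő measure `dθ/(2π |Q(e^{iθ})|²)` as a measure on `ℂ`. -/
def bsMeasure (Q : Polynomial ℂ) : Measure ℂ :=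
  Measure.map (fun θ : ℝ => Complex.exp (Complex.I * θ))
    ((volume.restrict (Set.Ioc 0 (2 * Real.pi))).withDensity
      (fun θ => ENNReal.ofReal ((2 * Real.pi * ‖Q.eval (Complex.exp (Complex.I * θ))‖ ^ 2)⁻¹)))

namespace OPUC

open ComplexConjugate

/-- `Q` is the monic orthogonal polynomial of degree `N` for `m`. -/
structure IsMonicOP (m : Measure ℂ) (N : ℕ) (Q : ℂ[X]) : Prop where
  monic : Q.Monic
  natDegree_eq : Q.natDegree = N
  orth : ∀ j < N, ∫ z, conj z ^ j * Q.eval z ∂m = 0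

section Polynomials

theorem coeff_revStar (n : ℕ) (P : ℂ[X]) (k : ℕ) :
    (revStar n P).coeff k = if k ≤ n then conj (P.coeff (n - k)) else 0 := by
  simp [revStar, coeff_C_mul, coeff_X_pow]

theorem eval_revStar {n : ℕ} {P : ℂ[X]} (hP : P.natDegree ≤ n) {z : ℂ} (hz : z ≠ 0) :
    (revStar n P).eval z = z ^ n * conj (P.eval (conj z)⁻¹) := by
  rw [eval_eq_sum_range' (Nat.lt_succ_of_le hP), revStar, eval_finsetSum,
    ← Finset.sum_range_reflect, map_sum, Finset.mul_sum]
  refine Finset.sum_congr rfl fun j hj => ?_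
  have hj' : j ≤ n := Nat.lt_succ_iff.1 (Finset.mem_range.1 hj)
  have h1 : n + 1 - 1 - j = n - j := by omega
  have h2 : n - (n - j) = j := by omega
  rw [h1, h2]
  simp only [eval_mul, eval_C, eval_pow, eval_X, map_mul, map_pow, map_inv₀, Complex.conj_conj]
  rw [pow_sub₀ z hz hj']
  ring

theorem inv_conj_of_norm_one {z : ℂ} (hz : ‖z‖ = 1) : (conj z)⁻¹ = z := by
  rw [← Complex.inv_eq_conj hz, inv_inv]

theorem ne_zero_of_norm_one {z : ℂ} (hz : ‖z‖ = 1) : z ≠ 0 := by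
  rintro rfl; simp at hz

theorem conj_mul_self_of_norm_one {z : ℂ} (hz : ‖z‖ = 1) : conj z * z = 1 := by
  rw [← Complex.inv_eq_conj hz, inv_mul_cancel₀ (ne_zero_of_norm_one hz)]

theorem eval_revStar_of_norm_one {n : ℕ} {P : ℂ[X]} (hP : P.natDegree ≤ n) {z : ℂ}
    (hz : ‖z‖ = 1) : (revStar n P).eval z = z ^ n * conj (P.eval z) := by
  rw [eval_revStar hP (ne_zero_of_norm_one hz), inv_conj_of_norm_one hz]

theorem eval_zero_revStar {P : ℂ[X]} (hP : P.Monic) : (revStar P.natDegree P).eval 0 = 1 := by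
  rw [← coeff_zero_eq_eval_zero, coeff_revStar]
  simp [hP]

theorem eval_revStar_ne_zero {P : ℂ[X]} (hP : P.Monic)
    (hroots : ∀ z, P.eval z = 0 → ‖z‖ < 1) {z : ℂ} (hz : ‖z‖ ≤ 1) :
    (revStar P.natDegree P).eval z ≠ 0 := by
  rcases eq_or_ne z 0 with rfl | h0
  · rw [eval_zero_revStar hP]; exact one_ne_zero
  · rw [eval_revStar le_rfl h0]
    refine mul_ne_zero (pow_ne_zero _ h0) fun h => ?_
    have h1 := hroots _ ((map_eq_zero _).1 h)
    rw [norm_inv, Complex.norm_conj] at h1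
    exact absurd h1 (not_lt.2 ((one_le_inv₀ (norm_pos_iff.2 h0)).2 hz))

theorem norm_eval_zero_lt_one {P : ℂ[X]} (hP : P.Monic) (hdeg : P.natDegree ≠ 0)
    (hroots : ∀ z, P.eval z = 0 → ‖z‖ < 1) : ‖P.eval 0‖ < 1 := by
  rw [← coeff_zero_eq_eval_zero,
    (IsAlgClosed.splits P).coeff_zero_eq_prod_roots_of_monic hP, norm_mul, norm_pow, norm_neg,
    norm_one, one_pow, one_mul]
  have hcard : P.roots ≠ 0 := by
    intro h
    exact hdeg (by rw [(IsAlgClosed.splits P).natDegree_eq_card_roots, h, Multiset.card_zero])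
  have key : ∀ s : Multiset ℂ, (∀ z ∈ s, ‖z‖ < 1) → ‖s.prod‖ ≤ 1 := by
    intro s
    induction s using Multiset.induction_on with
    | empty => simp
    | cons a s ih =>
      intro h
      rw [Multiset.prod_cons, norm_mul]
      exact mul_le_one₀ (h a (Multiset.mem_cons_self a s)).le (norm_nonneg _)
        (ih fun z hz => h z (Multiset.mem_cons_of_mem hz))
  obtain ⟨a, ha⟩ := Multiset.exists_mem_of_ne_zero hcard
  obtain ⟨t, ht⟩ := Multiset.exists_cons_of_mem ha
  have hlt : ∀ z ∈ P.roots, ‖z‖ < 1 := fun z hz => hroots z (isRoot_of_mem_roots hz)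
  rw [ht] at hlt ⊢
  rw [Multiset.prod_cons, norm_mul]
  exact mul_lt_one_of_nonneg_of_lt_one_left (norm_nonneg _) (hlt a (Multiset.mem_cons_self a t))
    (key t fun z hz => hlt z (Multiset.mem_cons_of_mem hz))

end Polynomials

section CircleMeasure

variable {m : Measure ℂ}

theorem ae_norm_eq_one (hm : m {z : ℂ | ‖z‖ = 1}ᶜ = 0) : ∀ᵐ z ∂m, ‖z‖ = 1 := hm

theorem integrable_of_continuous [IsFiniteMeasure m] (hm : m {z : ℂ | ‖z‖ = 1}ᶜ = 0)
    {E : Type*} [NormedAddCommGroup E] [SecondCountableTopology E] {f : ℂ → E}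
    (hf : Continuous f) : Integrable f m := by
  obtain ⟨C, hC⟩ := (isCompact_sphere (0 : ℂ) 1).exists_bound_of_continuousOn hf.continuousOn
  refine Integrable.of_bound hf.aestronglyMeasurable C ?_
  filter_upwards [ae_norm_eq_one hm] with z hz
  exact hC z (by simpa using hz)

theorem integral_conj_eval_mul_eq_zero [IsFiniteMeasure m] (hm : m {z : ℂ | ‖z‖ = 1}ᶜ = 0)
    {N : ℕ} {Q R : ℂ[X]} (hQ : ∀ j < N, ∫ z, conj z ^ j * Q.eval z ∂m = 0)
    (hR : R.degree < N) : ∫ z, conj (R.eval z) * Q.eval z ∂m = 0 := by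
  rcases eq_or_ne R 0 with rfl | hR0
  · simp
  have hR' : R.natDegree < N := (natDegree_lt_iff_degree_lt hR0).2 hR
  have h : ∀ z, conj (R.eval z) * Q.eval z =
      ∑ j ∈ Finset.range N, conj (R.coeff j) * (conj z ^ j * Q.eval z) := by
    intro z
    rw [eval_eq_sum_range' hR', map_sum, Finset.sum_mul]
    refine Finset.sum_congr rfl fun j _ => ?_
    rw [map_mul, map_pow, mul_assoc]
  simp_rw [h]
  rw [integral_finsetSum]
  · refine Finset.sum_eq_zero fun j hj => ?_
    rw [integral_const_mul, hQ j (Finset.mem_range.1 hj), mul_zero]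
  · intro j _
    exact integrable_of_continuous hm (by fun_prop)

theorem integral_norm_sq_pos (hm : IsNontrivialOnCircle m) {P : ℂ[X]} (hP : P ≠ 0) :
    0 < ∫ z, ‖P.eval z‖ ^ 2 ∂m := by
  have := hm.prob
  refine lt_of_le_of_ne (integral_nonneg fun z => by positivity) fun h => ?_
  have h0 := (integral_eq_zero_iff_of_nonneg (fun z => by positivity)
    (integrable_of_continuous hm.onCircle (by fun_prop))).1 h.symm
  refine hm.infiniteSupport P.roots.toFinset (measure_mono_null (fun z hz => ?_) h0)
  intro h1
  apply hz
  simp only [Pi.zero_apply] at h1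
  simpa [hP] using h1

theorem norm_lt_one_of_eval_eq_zero (hm : IsNontrivialOnCircle m) {N : ℕ} {Q : ℂ[X]}
    (hQ : IsMonicOP m N Q) {w : ℂ} (hw : Q.eval w = 0) : ‖w‖ < 1 := by
  have := hm.prob
  obtain ⟨P, rfl⟩ := dvd_iff_isRoot.2 hw
  set Q := (X - C w) * P with hQdef
  have hQ0 : Q ≠ 0 := hQ.monic.ne_zero
  have hP0 : P ≠ 0 := right_ne_zero_of_mul hQ0
  have hdeg : P.degree < N := by
    rw [← natDegree_lt_iff_degree_lt hP0, ← hQ.natDegree_eq, hQdef,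
      natDegree_mul (X_sub_C_ne_zero w) hP0, natDegree_X_sub_C]
    omega
  have horth := integral_conj_eval_mul_eq_zero hm.onCircle hQ.orth hdeg
  have hint : ∀ R : ℂ[X], Integrable (fun z => ‖R.eval z‖ ^ 2) m := fun R =>
    integrable_of_continuous hm.onCircle (by fun_prop)
  have hint' : Integrable (fun z => conj (P.eval z) * Q.eval z) m :=
    integrable_of_continuous hm.onCircle (by fun_prop)
  have hintre : Integrable (fun z => (conj w * (conj (P.eval z) * Q.eval z)).re) m :=
    (hint'.const_mul (conj w)).re
  have hre : ∫ z, (conj w * (conj (P.eval z) * Q.eval z)).re ∂m = 0 := by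
    have := integral_re (𝕜 := ℂ) (hint'.const_mul (conj w))
    rw [integral_const_mul, horth, mul_zero] at this
    simpa using this
  have key : ∫ z, ‖P.eval z‖ ^ 2 ∂m =
      ∫ z, (‖Q.eval z‖ ^ 2 + ‖w‖ ^ 2 * ‖P.eval z‖ ^ 2 +
        2 * (conj w * (conj (P.eval z) * Q.eval z)).re) ∂m := by
    refine integral_congr_ae ?_
    filter_upwards [ae_norm_eq_one hm.onCircle] with z hz
    have h1 : ‖P.eval z‖ ^ 2 = ‖Q.eval z + w * P.eval z‖ ^ 2 := by
      have : Q.eval z + w * P.eval z = z * P.eval z := by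
        simp only [hQdef, eval_mul, eval_sub, eval_X, eval_C]; ring
      rw [this, norm_mul, hz, one_mul]
    refine h1.trans ?_
    rw [← mul_pow, ← norm_mul, ← Complex.normSq_eq_norm_sq, ← Complex.normSq_eq_norm_sq,
      ← Complex.normSq_eq_norm_sq, Complex.normSq_add,
      Complex.normSq_mul, map_mul, mul_comm (Q.eval z), mul_assoc]
  rw [integral_add (by exact (hint Q).add ((hint P).const_mul _)) (hintre.const_mul 2),
    integral_add (hint Q) ((hint P).const_mul _), integral_const_mul, integral_const_mul,
    hre] at key
  have hPpos := integral_norm_sq_pos hm hP0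
  have hQpos := integral_norm_sq_pos hm hQ0
  by_contra! hge
  nlinarith [mul_le_mul hge hge zero_le_one (norm_nonneg w)]

theorem IsMonicOP.unique (hm : IsNontrivialOnCircle m) {N : ℕ} {P Q : ℂ[X]}
    (hP : IsMonicOP m N P) (hQ : IsMonicOP m N Q) : P = Q := by
  have := hm.prob
  by_contra hne
  have hD : P - Q ≠ 0 := sub_ne_zero.2 hne
  have hdeg : (P - Q).degree < N := by
    have h := degree_sub_lt_left (p := P) (q := Q)
      (by rw [degree_eq_natDegree hP.monic.ne_zero, degree_eq_natDegree hQ.monic.ne_zero,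
        hP.natDegree_eq, hQ.natDegree_eq]) hP.monic.ne_zero
      (by rw [hP.monic.leadingCoeff, hQ.monic.leadingCoeff])
    rwa [degree_eq_natDegree hP.monic.ne_zero, hP.natDegree_eq] at h
  have h1 := integral_conj_eval_mul_eq_zero hm.onCircle hP.orth hdeg
  have h2 := integral_conj_eval_mul_eq_zero hm.onCircle hQ.orth hdeg
  have h3 : ∫ z, ((‖(P - Q).eval z‖ ^ 2 : ℝ) : ℂ) ∂m = 0 := by
    rw [← sub_zero (0 : ℂ)]
    nth_rewrite 1 [← h1]
    rw [← h2, ← integral_sub (integrable_of_continuous hm.onCircle (by fun_prop))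
      (integrable_of_continuous hm.onCircle (by fun_prop))]
    congr 1 with z
    rw [← mul_sub, ← eval_sub, ← Complex.normSq_eq_norm_sq, Complex.normSq_eq_conj_mul_self]
  rw [integral_complex_ofReal, Complex.ofReal_eq_zero] at h3
  exact (integral_norm_sq_pos hm hD).ne' h3

theorem IsMonicOP.integral_conj_pow_mul [IsFiniteMeasure m] (hm : m {z : ℂ | ‖z‖ = 1}ᶜ = 0)
    {N : ℕ} {Q : ℂ[X]} (hQ : IsMonicOP m N Q) :
    ∫ z, conj z ^ N * Q.eval z ∂m = (polyNormSq m Q : ℂ) := by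
  have hdeg : (Q - X ^ N).degree < (N : WithBot ℕ) := by
    have h := degree_sub_lt_left (p := Q) (q := X ^ N)
      (by rw [degree_eq_natDegree hQ.monic.ne_zero, hQ.natDegree_eq, degree_X_pow])
      hQ.monic.ne_zero (by rw [hQ.monic.leadingCoeff, leadingCoeff_X_pow])
    rwa [degree_eq_natDegree hQ.monic.ne_zero, hQ.natDegree_eq] at h
  have h1 := integral_conj_eval_mul_eq_zero hm hQ.orth hdeg
  rw [polyNormSq, ← integral_complex_ofReal, ← add_zero (∫ z, conj z ^ N * Q.eval z ∂m), ← h1,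
    ← integral_add (integrable_of_continuous hm (by fun_prop))
      (integrable_of_continuous hm (by fun_prop))]
  congr 1 with z
  rw [← Complex.normSq_eq_norm_sq, Complex.normSq_eq_conj_mul_self]
  simp only [eval_sub, eval_pow, eval_X, map_sub, map_pow]
  ring

/-- The inverse Szegő recursion, uniformly in the measure. -/
theorem exists_isMonicOP_pred {N : ℕ} {Q : ℂ[X]} (hQm : Q.Monic) (hQd : Q.natDegree = N + 1)
    (hQ0 : ‖Q.eval 0‖ < 1) :
    ∃ P : ℂ[X], ∀ m : Measure ℂ, IsFiniteMeasure m → m {z : ℂ | ‖z‖ = 1}ᶜ = 0 →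
      IsMonicOP m (N + 1) Q → IsMonicOP m N P ∧
      ∫ z, conj z ^ N * P.eval z ∂m =
        (1 - (‖Q.eval 0‖ : ℂ) ^ 2)⁻¹ * ∫ z, conj z ^ (N + 1) * Q.eval z ∂m := by
  set q := Q.eval 0 with hq
  set r : ℂ := 1 - (‖q‖ : ℂ) ^ 2 with hr
  have hr0 : r ≠ 0 := by
    rw [hr, ← Complex.ofReal_one, ← Complex.ofReal_pow, ← Complex.ofReal_sub,
      Complex.ofReal_ne_zero]
    nlinarith [norm_nonneg q]
  have hQc : Q.coeff (N + 1) = 1 := hQd ▸ hQm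
  have hQc0 : Q.coeff 0 = q := coeff_zero_eq_eval_zero Q
  set S := Q - C q * revStar (N + 1) Q with hS
  have hS0 : S.coeff 0 = 0 := by
    simp [hS, coeff_revStar, hQc, hQc0]
  have hPd : (C r⁻¹ * S.divX).natDegree ≤ N := by
    refine natDegree_le_iff_coeff_eq_zero.2 fun k hk => ?_
    have h1 : Q.coeff (k + 1) = 0 := coeff_eq_zero_of_natDegree_lt (by omega)
    have h2 : ¬ k ≤ N := by omega
    simp [hS, coeff_divX, coeff_revStar, h1, h2]
  have hPc : (C r⁻¹ * S.divX).coeff N = 1 := by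
    have : q * conj q = (‖q‖ : ℂ) ^ 2 := Complex.mul_conj' q
    simp only [coeff_C_mul, coeff_divX, hS, coeff_sub, coeff_revStar, hQc, le_refl, if_true,
      Nat.sub_self, hQc0, this]
    exact inv_mul_cancel₀ hr0
  have hev : ∀ z, ‖z‖ = 1 → ∀ j, conj z ^ j * (C r⁻¹ * S.divX).eval z =
      r⁻¹ * (conj z ^ (j + 1) * (Q.eval z - q * (revStar (N + 1) Q).eval z)) := by
    intro z hz j
    have h1 : S.divX.eval z * z = Q.eval z - q * (revStar (N + 1) Q).eval z := by
      have := congrArg (eval z) (divX_mul_X_add S)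
      rw [hS0] at this
      simpa [hS] using this
    rw [← h1, eval_mul, eval_C, pow_succ]
    linear_combination (-(r⁻¹ * conj z ^ j * S.divX.eval z)) * conj_mul_self_of_norm_one hz
  refine ⟨C r⁻¹ * S.divX, fun m hfin hm hQ => ?_⟩
  have hstar : ∀ j ≤ N, ∫ z, conj z ^ (j + 1) * (revStar (N + 1) Q).eval z ∂m = 0 := by
    intro j hj
    have h1 := hQ.orth (N - j) (by omega)
    have h2 : ∫ z, conj z ^ (j + 1) * (revStar (N + 1) Q).eval z ∂m =
        ∫ z, conj (conj z ^ (N - j) * Q.eval z) ∂m := by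
      refine integral_congr_ae ?_
      filter_upwards [ae_norm_eq_one hm] with z hz
      have h3 : conj z ^ (j + 1) * z ^ (j + 1) = 1 := by
        rw [← mul_pow, conj_mul_self_of_norm_one hz, one_pow]
      have h4 : z ^ (N + 1) = z ^ (j + 1) * z ^ (N - j) := by
        rw [← pow_add]; congr 1; omega
      rw [eval_revStar_of_norm_one hQd.le hz, h4, map_mul, map_pow, Complex.conj_conj]
      linear_combination (z ^ (N - j) * conj (Q.eval z)) * h3
    rw [h2, integral_conj, h1, map_zero]
  have hint : ∀ j ≤ N, ∫ z, conj z ^ j * (C r⁻¹ * S.divX).eval z ∂m =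
      r⁻¹ * ∫ z, conj z ^ (j + 1) * Q.eval z ∂m := by
    intro j hj
    have h1 : ∫ z, conj z ^ j * (C r⁻¹ * S.divX).eval z ∂m =
        ∫ z, r⁻¹ * (conj z ^ (j + 1) * Q.eval z -
          q * (conj z ^ (j + 1) * (revStar (N + 1) Q).eval z)) ∂m := by
      refine integral_congr_ae ?_
      filter_upwards [ae_norm_eq_one hm] with z hz
      rw [hev z hz]
      ring
    rw [h1, integral_const_mul, integral_sub (integrable_of_continuous hm (by fun_prop))
      (integrable_of_continuous hm (by fun_prop)), integral_const_mul, hstar j hj, mul_zero,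
      sub_zero]
  have hmon := monic_of_natDegree_le_of_coeff_eq_one N hPd hPc
  refine ⟨⟨hmon, le_antisymm hPd (le_natDegree_of_ne_zero (by rw [hPc]; exact one_ne_zero)),
    fun j hj => ?_⟩, hint N le_rfl⟩
  rw [hint j hj.le, hQ.orth (j + 1) (by omega), mul_zero]

end CircleMeasure

section BernsteinSzego

theorem continuous_exp_I_mul : Continuous fun θ : ℝ => Complex.exp (Complex.I * θ) := by
  fun_prop

theorem norm_exp_I_mul (θ : ℝ) : ‖Complex.exp (Complex.I * θ)‖ = 1 := by
  rw [mul_comm, Complex.norm_exp_ofReal_mul_I]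

theorem circleMap_zero_one (θ : ℝ) : circleMap 0 1 θ = Complex.exp (Complex.I * θ) := by
  simp [circleMap, mul_comm]

theorem bsMeasure_compl_circle (Q : ℂ[X]) : bsMeasure Q {z : ℂ | ‖z‖ = 1}ᶜ = 0 := by
  rw [bsMeasure, Measure.map_apply continuous_exp_I_mul.measurable
    (isClosed_eq continuous_norm continuous_const).measurableSet.compl]
  simp

theorem isFiniteMeasure_bsMeasure {Q : ℂ[X]} (hQ : ∀ z, ‖z‖ = 1 → Q.eval z ≠ 0) :
    IsFiniteMeasure (bsMeasure Q) := by
  have hc : Continuous fun θ : ℝ =>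
      (2 * Real.pi * ‖Q.eval (Complex.exp (Complex.I * θ))‖ ^ 2)⁻¹ := by
    refine Continuous.inv₀ (by fun_prop) fun θ => ?_
    have := norm_pos_iff.2 (hQ _ (norm_exp_I_mul θ))
    have := Real.pi_pos
    positivity
  have := isFiniteMeasure_withDensity_ofReal
    (hc.integrableOn_Ioc (μ := volume) (a := 0) (b := 2 * Real.pi)).2
  unfold bsMeasure
  infer_instance

theorem bsMeasure_finset (Q : ℂ[X]) (s : Finset ℂ) : bsMeasure Q s = 0 := by
  rw [bsMeasure, Measure.map_apply continuous_exp_I_mul.measurable s.measurableSet]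
  refine withDensity_absolutelyContinuous _ _ ?_
  rw [Measure.restrict_apply (continuous_exp_I_mul.measurable s.measurableSet)]
  have hinj : Set.InjOn (fun θ : ℝ => Complex.exp (Complex.I * θ))
      (Set.Ioc 0 (2 * Real.pi)) := by
    have h := injOn_circleMap_of_abs_sub_le (a := 0) (b := 2 * Real.pi) (c := 0) one_ne_zero
      (by simp [abs_of_pos Real.pi_pos])
    rw [Set.uIoc_of_le Real.two_pi_pos.le] at h
    exact fun x hx y hy hxy => h hx hy (by simpa only [circleMap_zero_one] using hxy)
  refine Set.Finite.measure_zero ?_ _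
  refine Set.Finite.of_finite_image (s.finite_toSet.subset (Set.image_subset_iff.2
    (Set.inter_subset_left))) (hinj.mono Set.inter_subset_right)

theorem integral_bsMeasure (Q : ℂ[X]) {f : ℂ → ℂ} (hf : Continuous f) :
    ∫ z, f z ∂(bsMeasure Q) =
      Real.circleAverage (fun z => ((‖Q.eval z‖ ^ 2)⁻¹ : ℝ) • f z) 0 1 := by
  rw [bsMeasure, integral_map continuous_exp_I_mul.aemeasurable hf.aestronglyMeasurable,
    integral_withDensity_eq_integral_toReal_smul (by fun_prop)
      (Eventually.of_forall fun _ => ENNReal.ofReal_lt_top),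
    Real.circleAverage, intervalIntegral.integral_of_le Real.two_pi_pos.le, ← integral_smul]
  refine integral_congr_ae (Eventually.of_forall fun θ => ?_)
  have := Real.pi_pos
  simp only [circleMap_zero_one]
  rw [ENNReal.toReal_ofReal (by positivity), mul_inv, mul_smul]

/-- The mean value property gives the moments of `z ^ k * Q` for the measure
`dθ / (2π |φ|²)`, `φ = Q / ‖Q‖`. -/
theorem integral_bsMeasure_orthonormalize {μ : Measure ℂ} {Q : ℂ[X]} (hQm : Q.Monic)
    (hroots : ∀ z, Q.eval z = 0 → ‖z‖ < 1) {j k : ℕ} (hjk : j ≤ Q.natDegree + k) :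
    ∫ z, conj z ^ j * (X ^ k * Q).eval z ∂(bsMeasure (orthonormalize μ Q)) =
      polyNormSq μ Q * 0 ^ (Q.natDegree + k - j) := by
  set c := polyNormSq μ Q with hc
  have hc0 : 0 ≤ c := integral_nonneg fun z => by positivity
  set S := revStar Q.natDegree Q with hS
  have hS0 : ∀ z : ℂ, ‖z‖ ≤ 1 → S.eval z ≠ 0 := fun z hz => eval_revStar_ne_zero hQm hroots hz
  rw [integral_bsMeasure _ (by fun_prop)]
  have hcongr : Set.EqOn (fun z => ((‖(orthonormalize μ Q).eval z‖ ^ 2)⁻¹ : ℝ) •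
      (conj z ^ j * (X ^ k * Q).eval z))
      (fun z => c * (z ^ (Q.natDegree + k - j) / S.eval z)) (Metric.sphere 0 |1|) := by
    intro z hz
    have hz1 : ‖z‖ = 1 := by simpa using hz
    have hQz : Q.eval z ≠ 0 := fun h => (hroots z h).ne hz1
    have hnorm : ‖(orthonormalize μ Q).eval z‖ ^ 2 = c⁻¹ * ‖Q.eval z‖ ^ 2 := by
      rw [orthonormalize, eval_mul, eval_C, norm_mul, mul_pow, norm_inv, Complex.norm_real,
        inv_pow, Real.norm_eq_abs, sq_abs, Real.sq_sqrt hc0]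
    have hz0 := ne_zero_of_norm_one hz1
    have hcQ : conj (Q.eval z) ≠ 0 := (_root_.map_ne_zero _).2 hQz
    simp only [hnorm, hS, eval_revStar_of_norm_one le_rfl hz1, Complex.real_smul]
    rw [mul_inv, inv_inv, Complex.ofReal_mul, Complex.ofReal_inv, Complex.ofReal_pow,
      ← Complex.mul_conj', pow_sub₀ z hz0 hjk, ← Complex.inv_eq_conj hz1, eval_mul, eval_pow,
      eval_X, inv_pow, pow_add]
    field_simp
  rw [Real.circleAverage_congr_sphere hcongr,
    circleAverage_of_differentiable_on_off_countable Set.countable_empty]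
  · simp [hS, eval_zero_revStar hQm]
  · refine ContinuousOn.mul continuousOn_const (ContinuousOn.div (by fun_prop) (by fun_prop) ?_)
    intro z hz
    exact hS0 z (by simpa using hz)
  · intro z hz
    have hz1 : ‖z‖ < 1 := by simpa using hz
    exact (DifferentiableAt.div (by fun_prop) S.differentiableAt (hS0 z hz1.le)).const_mul _

end BernsteinSzego

section Main

variable {μ : Measure ℂ} {Φ : ℕ → ℂ[X]}

theorem isMonicOP_of_isMonicOPUC (hΦ : IsMonicOPUC μ Φ) (k : ℕ) : IsMonicOP μ k (Φ k) :=
  ⟨(hΦ k).1.1, (hΦ k).1.2, (hΦ k).2⟩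

/-- If `Φ n` is also orthogonal for a second measure `ν`, with the same norm, then so are
all `Φ k` with `k ≤ n`. -/
theorem isMonicOP_of_le (hμ : IsNontrivialOnCircle μ) (hΦ : IsMonicOPUC μ Φ)
    {ν : Measure ℂ} [IsFiniteMeasure ν] (hν : ν {z : ℂ | ‖z‖ = 1}ᶜ = 0) {n : ℕ}
    (hn : IsMonicOP ν n (Φ n))
    (hnorm : ∫ z, conj z ^ n * (Φ n).eval z ∂ν = ∫ z, conj z ^ n * (Φ n).eval z ∂μ)
    {k : ℕ} (hk : k ≤ n) :
    IsMonicOP ν k (Φ k) ∧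
      ∫ z, conj z ^ k * (Φ k).eval z ∂ν = ∫ z, conj z ^ k * (Φ k).eval z ∂μ := by
  have := hμ.prob
  induction hk using Nat.decreasingInduction with
  | self => exact ⟨hn, hnorm⟩
  | of_succ k _ ih =>
    have hop := isMonicOP_of_isMonicOPUC hΦ (k + 1)
    have hlt : ‖(Φ (k + 1)).eval 0‖ < 1 :=
      norm_eval_zero_lt_one hop.monic (by rw [hop.natDegree_eq]; omega)
        fun z hz => norm_lt_one_of_eval_eq_zero hμ hop hz
    obtain ⟨P, hP⟩ := exists_isMonicOP_pred hop.monic hop.natDegree_eq hlt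
    obtain ⟨h1, h2⟩ := hP μ inferInstance hμ.onCircle hop
    obtain ⟨h3, h4⟩ := hP ν inferInstance hν ih.1
    obtain rfl := h1.unique hμ (isMonicOP_of_isMonicOPUC hΦ k)
    exact ⟨h3, by rw [h4, h2, ih.2]⟩

end Main

end OPUC

/-- Bernstein–Szegő approximation: `dμ_n = dθ/(2π|φ_n(e^{iθ})|²)` is a
probability measure whose Verblunsky coefficients agree with those of `μ` for `j ≤ n−1`
and vanish for `j ≥ n`. -/
theorem stmt11 (μ : Measure ℂ) (hμ : IsNontrivialOnCircle μ)
    (Φ : ℕ → Polynomial ℂ) (hΦ : IsMonicOPUC μ Φ) (n : ℕ) :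
    IsProbabilityMeasure (bsMeasure (orthonormalize μ (Φ n))) ∧
    ∀ Φ' : ℕ → Polynomial ℂ, IsMonicOPUC (bsMeasure (orthonormalize μ (Φ n))) Φ' →
      (∀ j < n, verblunsky Φ' j = verblunsky Φ j) ∧
      (∀ j : ℕ, n ≤ j → verblunsky Φ' j = 0) := by
  have := hμ.prob
  have hop := OPUC.isMonicOP_of_isMonicOPUC hΦ n
  have hroots : ∀ z, (Φ n).eval z = 0 → ‖z‖ < 1 := fun z hz =>
    OPUC.norm_lt_one_of_eval_eq_zero hμ hop hz
  have hpos : 0 < polyNormSq μ (Φ n) := OPUC.integral_norm_sq_pos hμ hop.monic.ne_zero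
  set ν := bsMeasure (orthonormalize μ (Φ n)) with hνdef
  have hνc : ν {z : ℂ | ‖z‖ = 1}ᶜ = 0 := OPUC.bsMeasure_compl_circle _
  have hfin : IsFiniteMeasure ν := by
    refine OPUC.isFiniteMeasure_bsMeasure fun z hz => ?_
    rw [orthonormalize, eval_mul, eval_C]
    refine mul_ne_zero (inv_ne_zero ?_) fun h => (hroots z h).ne hz
    exact Complex.ofReal_ne_zero.2 (Real.sqrt_pos.2 hpos).ne'
  have hX : ∀ k, OPUC.IsMonicOP ν (n + k) (X ^ k * Φ n) := fun k =>
    ⟨(monic_X_pow k).mul hop.monic,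
      by rw [(monic_X_pow k).natDegree_mul hop.monic, natDegree_X_pow, hop.natDegree_eq, add_comm],
      fun j hj => by
        rw [OPUC.integral_bsMeasure_orthonormalize hop.monic hroots
          (by rw [hop.natDegree_eq]; exact hj.le), hop.natDegree_eq, zero_pow (by omega), mul_zero]⟩
  have hn : OPUC.IsMonicOP ν n (Φ n) := by simpa using hX 0
  have hnorm : ∫ z, (starRingEnd ℂ) z ^ n * (Φ n).eval z ∂ν =
      ∫ z, (starRingEnd ℂ) z ^ n * (Φ n).eval z ∂μ := by
    rw [hop.integral_conj_pow_mul hμ.onCircle]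
    have h := OPUC.integral_bsMeasure_orthonormalize (μ := μ) hop.monic hroots (j := n) (k := 0)
      (by rw [hop.natDegree_eq]; omega)
    simpa [hop.natDegree_eq] using h
  have hle : ∀ k ≤ n, _ := fun k hk => OPUC.isMonicOP_of_le hμ hΦ hνc hn hnorm hk
  have hprob : IsProbabilityMeasure ν := by
    have h := (hle 0 n.zero_le).2
    have h0 : Φ 0 = 1 := eq_one_of_monic_natDegree_zero (hΦ 0).1.1 (hΦ 0).1.2
    simp only [h0, pow_zero, eval_one, mul_one, integral_const, probReal_univ, one_smul,
      Complex.real_smul] at h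
    exact isProbabilityMeasure_iff_real.2 (by exact_mod_cast h)
  have hν : IsNontrivialOnCircle ν := by
    refine ⟨hprob, hνc, fun s hs => ?_⟩
    rw [prob_compl_eq_zero_iff s.measurableSet, OPUC.bsMeasure_finset] at hs
    exact zero_ne_one hs
  refine ⟨hprob, fun Φ' hΦ' => ⟨fun j hj => ?_, fun j hj => ?_⟩⟩
  · rw [verblunsky, verblunsky,
      (OPUC.isMonicOP_of_isMonicOPUC hΦ' (j + 1)).unique hν (hle (j + 1) hj).1]
  · have h := hX (j + 1 - n)
    rw [Nat.add_sub_cancel' (by omega)] at h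
    rw [verblunsky, (OPUC.isMonicOP_of_isMonicOPUC hΦ' (j + 1)).unique hν h, eval_mul, eval_pow,
      eval_X, zero_pow (by omega), zero_mul, map_zero, neg_zero]

end
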